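/- arXiv:1805.12529 — 3 statements merged into one kernel-verified Lean document; each statement's English description precedes it below -/
import Mathlib

section
/- Assume the generative model where in addition Z* has full row rank, and assume q := κ(Z*)^4 · max_{1≤k≤n} ‖D_k Z* D̃_k‖_2 < 1. Then for every q̄ with q < q̄ < 1 there exists ε > 0 such that for every initial orthogonal matrix W^0 with ‖W^0 − W*‖_F ≤ ε, the iterates of the alternating algorithm satisfy, for all t ≥ 1: ‖Z^t − Z*‖_F ≤ q̄^{t−1} ε and ‖W^t − W*‖_F ≤ q̄^t ε. In particular the iterates converge linearly to the underlying model (Z*, W*). -/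
open Matrix MeasureTheory ProbabilityTheory Filter
open scoped Kronecker

noncomputable section

/-- Frobenius norm of a real matrix. -/
def frobNorm {m n : Type*} [Fintype m] [Fintype n] (M : Matrix m n ℝ) : ℝ :=
  Real.sqrt (∑ i, ∑ j, (M i j) ^ 2)

/-- Spectral norm (largest singular value) of a real matrix. -/
def specNorm {m n : Type*} [Fintype m] [Fintype n] [DecidableEq n] (M : Matrix m n ℝ) : ℝ :=
  ‖LinearMap.toContinuousLinearMap (Matrix.toEuclideanLin M)‖

/-- Smallest singular value of a real matrix (as the infimum of `‖Mᵀ x‖` over unit vectors). -/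
def sigmaMin {m n : Type*} [Fintype m] [Fintype n] [DecidableEq m] (M : Matrix m n ℝ) : ℝ :=
  sInf {c : ℝ | ∃ x : EuclideanSpace ℝ m, ‖x‖ = 1 ∧ c = ‖Matrix.toEuclideanLin Mᵀ x‖}

/-- Condition number: ratio of largest to smallest singular value. -/
def condNum {m n : Type*} [Fintype m] [Fintype n] [DecidableEq m] [DecidableEq n]
    (M : Matrix m n ℝ) : ℝ :=
  specNorm M / sigmaMin M

/-- `D_k`: diagonal matrix with ones on the diagonal except a zero at `(k,k)`. -/
def Dk {n : Type*} [Fintype n] [DecidableEq n] (k : n) : Matrix n n ℝ :=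
  Matrix.diagonal (fun i => if i = k then 0 else 1)

/-- `D̃_k`: diagonal matrix with ones at columns in the support of the `k`-th row of `Z`. -/
def Dtil {n N : Type*} [Fintype n] [Fintype N] [DecidableEq N]
    (Z : Matrix n N ℝ) (k : n) : Matrix N N ℝ :=
  Matrix.diagonal (fun j => if Z k j ≠ 0 then 1 else 0)

/-- `max_{1 ≤ k ≤ n} ‖D_k Z D̃_k‖₂`. -/
def qmax {n N : Type*} [Fintype n] [Fintype N] [DecidableEq n] [DecidableEq N]
    (Z : Matrix n N ℝ) : ℝ :=
  ⨆ k : n, specNorm (Dk k * Z * Dtil Z k)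

/-- `z = H_s(v)`: hard thresholding of `v` to its `s` largest-magnitude entries. -/
def IsHardThresh {n : ℕ} (s : ℕ) (v z : Fin n → ℝ) : Prop :=
  ∃ T : Finset (Fin n), T.card = s ∧ (∀ i ∈ T, ∀ j ∉ T, |v j| ≤ |v i|) ∧
    (∀ i ∈ T, z i = v i) ∧ (∀ i ∉ T, z i = 0)

/-- Euclidean norm of a vector. -/
def l2norm {n : ℕ} (v : Fin n → ℝ) : ℝ := Real.sqrt (∑ i, (v i) ^ 2)

/-- `β(v)`: smallest magnitude among the nonzero entries of `v`. -/
def betaMin {n : ℕ} (v : Fin n → ℝ) : ℝ :=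
  sInf {c : ℝ | ∃ i, v i ≠ 0 ∧ c = |v i|}

/-- The constant `C(ε₀)` from the convergence-radius analysis. -/
def Cconst (e : ℝ) : ℝ :=
  2 + 9 * Real.sqrt 2 / (8 * (1 - 2 * e - e ^ 2) ^ ((3 : ℝ) / 2)) + Real.sqrt 2 / (1 - e)

end

section FrobeniusNorm

variable {l m n : Type*} [Fintype l] [Fintype m] [Fintype n]

lemma frobNorm_nonneg (M : Matrix m n ℝ) : 0 ≤ frobNorm M := Real.sqrt_nonneg _

lemma frobNorm_sq (M : Matrix m n ℝ) : frobNorm M ^ 2 = ∑ i, ∑ j, M i j ^ 2 :=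
  Real.sq_sqrt (Finset.sum_nonneg fun _ _ => Finset.sum_nonneg fun _ _ => sq_nonneg _)

lemma frobNorm_sq_eq_sum_dotProduct (M : Matrix m n ℝ) :
    frobNorm M ^ 2 = ∑ i, M i ⬝ᵥ M i := by
  rw [frobNorm_sq]
  simp only [dotProduct, sq]

lemma frobNorm_sq_eq_trace (M : Matrix m n ℝ) : frobNorm M ^ 2 = (M * Mᵀ).trace := by
  rw [frobNorm_sq_eq_sum_dotProduct]
  rfl

lemma abs_apply_le_frobNorm (M : Matrix m n ℝ) (i : m) (j : n) : |M i j| ≤ frobNorm M := by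
  refine abs_le_of_sq_le_sq ?_ (frobNorm_nonneg M)
  rw [frobNorm_sq]
  exact (Finset.single_le_sum (f := fun j => M i j ^ 2) (fun _ _ => sq_nonneg _)
    (Finset.mem_univ j)).trans
    (Finset.single_le_sum (f := fun i => ∑ j, M i j ^ 2)
      (fun _ _ => Finset.sum_nonneg fun _ _ => sq_nonneg _) (Finset.mem_univ i))

lemma frobNorm_transpose (M : Matrix m n ℝ) : frobNorm Mᵀ = frobNorm M := by
  unfold frobNorm
  rw [Finset.sum_comm]
  rfl

lemma frobNorm_le_of_forall_row {M : Matrix m n ℝ} {M' : Matrix m l ℝ} {c : ℝ} (hc : 0 ≤ c)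
    (h : ∀ i, M i ⬝ᵥ M i ≤ c ^ 2 * (M' i ⬝ᵥ M' i)) : frobNorm M ≤ c * frobNorm M' := by
  refine (sq_le_sq₀ (frobNorm_nonneg _) (mul_nonneg hc (frobNorm_nonneg _))).mp ?_
  rw [mul_pow, frobNorm_sq_eq_sum_dotProduct, frobNorm_sq_eq_sum_dotProduct, Finset.mul_sum]
  exact Finset.sum_le_sum fun i _ => h i

lemma trace_mul_transpose_le (M M' : Matrix m n ℝ) :
    (M * M'ᵀ).trace ≤ frobNorm M * frobNorm M' := by
  have h := Finset.sum_mul_sq_le_sq_mul_sq (Finset.univ : Finset (m × n))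
    (fun p => M p.1 p.2) (fun p => M' p.1 p.2)
  have e : (M * M'ᵀ).trace = ∑ p : m × n, M p.1 p.2 * M' p.1 p.2 := by
    simp [Matrix.trace, Matrix.mul_apply, Fintype.sum_prod_type]
  refine le_of_abs_le (abs_le_of_sq_le_sq ?_ (mul_nonneg (frobNorm_nonneg _) (frobNorm_nonneg _)))
  rw [e, mul_pow, frobNorm_sq, frobNorm_sq]
  simpa [Fintype.sum_prod_type] using h

section
attribute [local instance] Matrix.frobeniusNormedAddCommGroup

lemma frobNorm_eq_norm (M : Matrix m n ℝ) : frobNorm M = ‖M‖ := by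
  rw [Matrix.frobenius_norm_def, frobNorm, Real.sqrt_eq_rpow]
  simp

lemma frobNorm_add_le (M M' : Matrix m n ℝ) : frobNorm (M + M') ≤ frobNorm M + frobNorm M' := by
  simpa only [frobNorm_eq_norm] using norm_add_le M M'

lemma frobNorm_sub_le (M M' : Matrix m n ℝ) : frobNorm (M - M') ≤ frobNorm M + frobNorm M' := by
  simpa only [frobNorm_eq_norm] using norm_sub_le M M'

lemma frobNorm_sub_comm (M M' : Matrix m n ℝ) : frobNorm (M - M') = frobNorm (M' - M) := by
  simpa only [frobNorm_eq_norm] using norm_sub_rev M M'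

lemma frobNorm_mul_le (M : Matrix l m ℝ) (M' : Matrix m n ℝ) :
    frobNorm (M * M') ≤ frobNorm M * frobNorm M' := by
  simpa only [frobNorm_eq_norm] using Matrix.frobenius_norm_mul M M'

end

lemma frobNorm_mul_of_mul_transpose_eq_one [DecidableEq n] (M : Matrix m n ℝ) {Q : Matrix n n ℝ}
    (hQ : Q * Qᵀ = 1) : frobNorm (M * Q) = frobNorm M := by
  rw [← sq_eq_sq₀ (frobNorm_nonneg _) (frobNorm_nonneg _), frobNorm_sq_eq_trace,
    frobNorm_sq_eq_trace, Matrix.transpose_mul, Matrix.mul_assoc, ← Matrix.mul_assoc Q, hQ,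
    Matrix.one_mul]

lemma frobNorm_orthogonal_mul [DecidableEq m] {Q : Matrix m m ℝ} (M : Matrix m n ℝ)
    (hQ : Qᵀ * Q = 1) : frobNorm (Q * M) = frobNorm M := by
  rw [← frobNorm_transpose, Matrix.transpose_mul, frobNorm_mul_of_mul_transpose_eq_one _ (by simpa),
    frobNorm_transpose]

end FrobeniusNorm

section SpectralNorm

variable {l m n : Type*} [Fintype l] [Fintype m] [Fintype n]

lemma specNorm_nonneg [DecidableEq n] (M : Matrix m n ℝ) : 0 ≤ specNorm M := norm_nonneg _

lemma norm_toEuclideanLin_sq [DecidableEq n] (M : Matrix m n ℝ) (x : EuclideanSpace ℝ n) :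
    ‖Matrix.toEuclideanLin M x‖ ^ 2 = (M *ᵥ x.ofLp) ⬝ᵥ (M *ᵥ x.ofLp) := by
  rw [EuclideanSpace.real_norm_sq_eq]
  simp [dotProduct, sq, Matrix.toLpLin_apply]

lemma norm_sq_eq_dotProduct (x : EuclideanSpace ℝ n) : ‖x‖ ^ 2 = x.ofLp ⬝ᵥ x.ofLp := by
  rw [EuclideanSpace.real_norm_sq_eq]
  simp [dotProduct, sq]

lemma norm_toEuclideanLin_le [DecidableEq n] (M : Matrix m n ℝ) (x : EuclideanSpace ℝ n) :
    ‖Matrix.toEuclideanLin M x‖ ≤ specNorm M * ‖x‖ :=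
  (LinearMap.toContinuousLinearMap (Matrix.toEuclideanLin M)).le_opNorm x

section
open scoped Matrix.Norms.L2Operator

lemma specNorm_transpose [DecidableEq m] [DecidableEq n] (M : Matrix m n ℝ) :
    specNorm Mᵀ = specNorm M := by
  have h := Matrix.l2_opNorm_conjTranspose M
  rw [Matrix.conjTranspose_eq_transpose_of_trivial] at h
  exact h

end

lemma vecMul_dotProduct_self_le [DecidableEq m] [DecidableEq n] (M : Matrix m n ℝ) (x : m → ℝ) :
    (x ᵥ* M) ⬝ᵥ (x ᵥ* M) ≤ specNorm M ^ 2 * (x ⬝ᵥ x) := by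
  have h := pow_le_pow_left₀ (norm_nonneg _) (norm_toEuclideanLin_le Mᵀ (WithLp.toLp 2 x)) 2
  rw [mul_pow, norm_toEuclideanLin_sq, norm_sq_eq_dotProduct, specNorm_transpose,
    Matrix.mulVec_transpose] at h
  exact h

lemma frobNorm_mul_le_specNorm [DecidableEq m] [DecidableEq n]
    (A : Matrix l m ℝ) (M : Matrix m n ℝ) : frobNorm (A * M) ≤ specNorm M * frobNorm A :=
  frobNorm_le_of_forall_row (specNorm_nonneg M) fun i => vecMul_dotProduct_self_le M (A i)

lemma specNorm_orthogonal_mul [DecidableEq m] [DecidableEq n] {Q : Matrix m m ℝ}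
    (M : Matrix m n ℝ) (hQ : Qᵀ * Q = 1) : specNorm (Q * M) = specNorm M := by
  have key : ∀ x, ‖Matrix.toEuclideanLin (Q * M) x‖ = ‖Matrix.toEuclideanLin M x‖ := by
    intro x
    rw [← sq_eq_sq₀ (norm_nonneg _) (norm_nonneg _), norm_toEuclideanLin_sq,
      norm_toEuclideanLin_sq, ← Matrix.mulVec_mulVec, Matrix.dotProduct_mulVec,
      Matrix.vecMul_mulVec, hQ, Matrix.vecMul_one]
  refine le_antisymm ?_ ?_
  · refine ContinuousLinearMap.opNorm_le_bound _ (specNorm_nonneg M) fun x => ?_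
    exact (key x).le.trans (norm_toEuclideanLin_le M x)
  · refine ContinuousLinearMap.opNorm_le_bound _ (specNorm_nonneg (Q * M)) fun x => ?_
    exact (key x).ge.trans (norm_toEuclideanLin_le (Q * M) x)

lemma sigmaMin_bddBelow [DecidableEq m] (M : Matrix m n ℝ) :
    BddBelow {c : ℝ | ∃ x : EuclideanSpace ℝ m, ‖x‖ = 1 ∧ c = ‖Matrix.toEuclideanLin Mᵀ x‖} :=
  ⟨0, by rintro _ ⟨x, -, rfl⟩; exact norm_nonneg _⟩

lemma sigmaMin_nonneg [DecidableEq m] (M : Matrix m n ℝ) : 0 ≤ sigmaMin M :=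
  Real.sInf_nonneg (by rintro _ ⟨x, -, rfl⟩; exact norm_nonneg _)

lemma sigmaMin_mul_norm_le [DecidableEq m] (M : Matrix m n ℝ) (x : EuclideanSpace ℝ m) :
    sigmaMin M * ‖x‖ ≤ ‖Matrix.toEuclideanLin Mᵀ x‖ := by
  rcases eq_or_ne x 0 with rfl | hx
  · simp
  have h0 : 0 < ‖x‖ := norm_pos_iff.mpr hx
  have h : sigmaMin M ≤ ‖Matrix.toEuclideanLin Mᵀ (‖x‖⁻¹ • x)‖ :=
    csInf_le (sigmaMin_bddBelow M) ⟨_, norm_smul_inv_norm (𝕜 := ℝ) hx, rfl⟩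
  rw [map_smul, norm_smul, norm_inv, norm_norm, ← div_eq_inv_mul, le_div_iff₀ h0] at h
  exact h

lemma sigmaMin_mul_frobNorm_le [DecidableEq m] (A : Matrix l m ℝ) (M : Matrix m n ℝ) :
    sigmaMin M * frobNorm A ≤ frobNorm (A * M) := by
  refine (sq_le_sq₀ (mul_nonneg (sigmaMin_nonneg _) (frobNorm_nonneg _))
    (frobNorm_nonneg _)).mp ?_
  rw [mul_pow, frobNorm_sq_eq_sum_dotProduct, frobNorm_sq_eq_sum_dotProduct, Finset.mul_sum]
  refine Finset.sum_le_sum fun i _ => ?_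
  have h := pow_le_pow_left₀ (mul_nonneg (sigmaMin_nonneg M) (norm_nonneg _))
    (sigmaMin_mul_norm_le M (WithLp.toLp 2 (A i))) 2
  rw [mul_pow, norm_toEuclideanLin_sq, norm_sq_eq_dotProduct, Matrix.mulVec_transpose] at h
  exact h

lemma sigmaMin_le_specNorm [DecidableEq m] [DecidableEq n] [Nonempty m] (M : Matrix m n ℝ) :
    sigmaMin M ≤ specNorm M := by
  obtain ⟨x, hx⟩ := exists_norm_eq (EuclideanSpace ℝ m) zero_le_one
  have h1 := sigmaMin_mul_norm_le M x
  have h2 := norm_toEuclideanLin_le Mᵀ x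
  rw [hx, mul_one] at h1 h2
  exact (h1.trans h2).trans_eq (specNorm_transpose M)

lemma sigmaMin_pos [DecidableEq m] [Nonempty m] (M : Matrix m n ℝ)
    (hM : M.rank = Fintype.card m) : 0 < sigmaMin M := by
  have hli : LinearIndependent ℝ Mᵀ.col := by
    rw [← Matrix.rank_transpose] at hM
    rw [linearIndependent_iff_card_eq_finrank_span, ← hM, Matrix.rank_eq_finrank_span_cols]
    rfl
  have hinj : Function.Injective (Matrix.toEuclideanLin Mᵀ) := by
    intro x y hxy
    have := Matrix.mulVec_injective_iff.mpr hli (a₁ := x.ofLp) (a₂ := y.ofLp)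
      (congrArg WithLp.ofLp hxy)
    exact WithLp.ofLp_injective 2 this
  obtain ⟨K, hK, hanti⟩ := (LinearMap.injective_iff_antilipschitz _).mp hinj
  have hK' : (0 : ℝ) < K := hK
  obtain ⟨x, hx⟩ := exists_norm_eq (EuclideanSpace ℝ m) zero_le_one
  refine lt_of_lt_of_le (inv_pos.mpr hK') (le_csInf ⟨_, x, hx, rfl⟩ ?_)
  rintro _ ⟨y, hy, rfl⟩
  have := hanti.le_mul_dist y 0
  rw [map_zero, dist_zero_right, dist_zero_right, hy] at this
  rwa [inv_le_iff_one_le_mul₀ hK', mul_comm]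

lemma specNorm_le_qmax [DecidableEq m] [DecidableEq n] (Z : Matrix m n ℝ) (k : m) :
    specNorm (Dk k * Z * Dtil Z k) ≤ qmax Z :=
  le_ciSup (f := fun k => specNorm (Dk k * Z * Dtil Z k)) (Set.finite_range _).bddAbove k

end SpectralNorm

section Procrustes

variable {m n : Type*} [Fintype m] [Fintype n] [DecidableEq m]

section
attribute [local instance] Matrix.linftyOpNormedRing Matrix.linftyOpNormedAlgebra

lemma isSymm_of_trace_mul_le (S : Matrix m m ℝ)
    (h : ∀ R : Matrix m m ℝ, Rᵀ * R = 1 → (R * S).trace ≤ S.trace) : Sᵀ = S := by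
  set X : Matrix m m ℝ := Sᵀ - S with hX
  have hXt : Xᵀ = -X := by simp [hX]
  have hd : HasDerivAt (fun t : ℝ => (NormedSpace.exp (t • X) * S).trace) (X * S).trace 0 := by
    have h1 := hasDerivAt_exp_smul_const (𝕂 := ℝ) X (0 : ℝ)
    rw [zero_smul, NormedSpace.exp_zero, one_mul] at h1
    exact ((Matrix.traceLinearMap m ℝ ℝ).toContinuousLinearMap.hasFDerivAt.comp_hasDerivAt 0
      (h1.mul_const S))
  have hmax : IsLocalMax (fun t : ℝ => (NormedSpace.exp (t • X) * S).trace) 0 := by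
    refine Eventually.of_forall fun t => ?_
    simp only [zero_smul, NormedSpace.exp_zero, one_mul]
    refine h _ ?_
    rw [← Matrix.exp_transpose, Matrix.transpose_smul, hXt, smul_neg, Matrix.exp_neg]
    exact Matrix.nonsing_inv_mul _ ((Matrix.isUnit_iff_isUnit_det _).mp (Matrix.isUnit_exp _))
  have hz : (X * S).trace = 0 := hmax.hasDerivAt_eq_zero hd
  have hz' : (X * Sᵀ).trace = 0 := by
    rw [← Matrix.trace_transpose, Matrix.transpose_mul, Matrix.transpose_transpose, hXt,
      Matrix.trace_mul_comm, Matrix.neg_mul, Matrix.trace_neg, hz, neg_zero]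
  have hfz : frobNorm X ^ 2 = 0 := by
    rw [frobNorm_sq_eq_trace, hXt, hX, neg_sub, Matrix.mul_sub, Matrix.trace_sub, ← hX, hz, hz',
      sub_zero]
  have : X = 0 := by
    ext i j
    have := abs_apply_le_frobNorm X i j
    rw [pow_eq_zero_iff two_ne_zero] at hfz
    rw [hfz] at this
    simpa using this
  exact sub_eq_zero.mp this

end

lemma frobNorm_orthogonal_mul_sub_sq {Q : Matrix m m ℝ} (hQ : Qᵀ * Q = 1) (Z Y : Matrix m n ℝ) :
    frobNorm (Q * Z - Y) ^ 2
      = frobNorm Z ^ 2 + frobNorm Y ^ 2 - 2 * (Q * (Z * Yᵀ)).trace := by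
  have h : (Y * (Q * Z)ᵀ).trace = (Q * (Z * Yᵀ)).trace := by
    rw [← Matrix.trace_transpose, Matrix.transpose_mul, Matrix.transpose_transpose,
      Matrix.mul_assoc]
  rw [← frobNorm_orthogonal_mul Z hQ, frobNorm_sq_eq_trace, frobNorm_sq_eq_trace,
    frobNorm_sq_eq_trace, Matrix.transpose_sub, Matrix.mul_sub, Matrix.sub_mul, Matrix.sub_mul,
    Matrix.trace_sub, Matrix.trace_sub, Matrix.trace_sub, h, ← Matrix.mul_assoc Q]
  ring

lemma isSymm_of_procrustes {Q : Matrix m m ℝ} (hQ : Qᵀ * Q = 1) (Z Y : Matrix m n ℝ)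
    (hmin : ∀ R : Matrix m m ℝ, Rᵀ * R = 1 → frobNorm (Q * Z - Y) ≤ frobNorm (R * Z - Y)) :
    (Q * (Z * Yᵀ))ᵀ = Q * (Z * Yᵀ) := by
  refine isSymm_of_trace_mul_le _ fun R hR => ?_
  have hRQ : (R * Q)ᵀ * (R * Q) = 1 := by
    rw [Matrix.transpose_mul, Matrix.mul_assoc, ← Matrix.mul_assoc Rᵀ, hR, Matrix.one_mul, hQ]
  have h := pow_le_pow_left₀ (frobNorm_nonneg _) (hmin _ hRQ) 2
  rw [frobNorm_orthogonal_mul_sub_sq hQ, frobNorm_orthogonal_mul_sub_sq hRQ] at h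
  rw [← Matrix.mul_assoc R]
  linarith

lemma procrustes_frobNorm_sub_one_le [DecidableEq n] {Q : Matrix m m ℝ} (Z Y : Matrix m n ℝ)
    (hmin : ∀ R : Matrix m m ℝ, Rᵀ * R = 1 → frobNorm (Q * Z - Y) ≤ frobNorm (R * Z - Y)) :
    sigmaMin Z * frobNorm (Q - 1) ≤ 2 * frobNorm (Y - Z) := by
  have h1 := hmin 1 (by simp)
  rw [Matrix.one_mul, frobNorm_sub_comm Z Y] at h1
  have h2 := frobNorm_add_le (Q * Z - Y) (Y - Z)
  have h3 := sigmaMin_mul_frobNorm_le (Q - 1) Z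
  rw [Matrix.sub_mul, Matrix.one_mul] at h3
  rw [sub_add_sub_cancel] at h2
  linarith

lemma sub_one_add_transpose_add_mul_transpose {Q : Matrix m m ℝ} (hQ : Q * Qᵀ = 1) :
    (Q - 1) + (Q - 1)ᵀ + (Q - 1) * (Q - 1)ᵀ = 0 := by
  rw [Matrix.transpose_sub, Matrix.transpose_one, Matrix.sub_mul, Matrix.mul_sub, hQ,
    Matrix.one_mul, Matrix.mul_one]
  abel

lemma procrustes_perturbation [DecidableEq n] {Q : Matrix m m ℝ} (hQ : Qᵀ * Q = 1)
    (Z Y : Matrix m n ℝ) (hZ : specNorm Z = 1)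
    (hmin : ∀ R : Matrix m m ℝ, Rᵀ * R = 1 → frobNorm (Q * Z - Y) ≤ frobNorm (R * Z - Y)) :
    sigmaMin Z ^ 2 * frobNorm (Q - 1)
      ≤ frobNorm ((Y - Z) * Zᵀ) + frobNorm (Q - 1) ^ 2 / 2 := by
  have hQ' : Q * Qᵀ = 1 := mul_eq_one_comm.mp hQ
  have hsym := isSymm_of_procrustes hQ Z Y hmin
  set B := Q - 1 with hB
  set E := (Y - Z) * Zᵀ with hE
  have hQB : Q = 1 + B := by simp [hB]
  have hBB : B + Bᵀ + B * Bᵀ = 0 := sub_one_add_transpose_add_mul_transpose hQ'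
  have hBt : Bᵀ = -B - B * Bᵀ := by
    have : Bᵀ = (B + Bᵀ + B * Bᵀ) - B - B * Bᵀ := by abel
    rw [hBB, zero_sub] at this
    exact this
  set G := Z * Zᵀ with hG
  have hYZ : Y * Zᵀ = G + E := by
    rw [hE, hG, Matrix.sub_mul]; abel
  have hZY : Z * Yᵀ = G + Eᵀ := by
    have := congrArg Matrix.transpose hYZ
    simpa [Matrix.transpose_mul, hG] using this
  have hEq : B * G + G * B + G * B * Bᵀ = E * Qᵀ - Q * Eᵀ := by
    rw [Matrix.transpose_mul, Matrix.transpose_mul, Matrix.transpose_transpose, hYZ, hZY,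
      Matrix.add_mul, Matrix.mul_add] at hsym
    have h1 : E * Qᵀ - Q * Eᵀ = Q * G - G * Qᵀ := by
      rw [sub_eq_sub_iff_add_eq_add, ← hsym]; abel
    rw [h1, hQB, Matrix.transpose_add, Matrix.transpose_one, Matrix.add_mul, Matrix.mul_add,
      Matrix.one_mul, Matrix.mul_one]
    have h2 : G * Bᵀ = -(G * B) - G * B * Bᵀ := by
      conv_lhs => rw [hBt, Matrix.mul_sub, Matrix.mul_neg, ← Matrix.mul_assoc]
    rw [h2]
    abel
  have hright : frobNorm (E * Qᵀ - Q * Eᵀ) ≤ 2 * frobNorm E := by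
    refine (frobNorm_sub_le _ _).trans ?_
    rw [frobNorm_mul_of_mul_transpose_eq_one _ (by simpa using hQ),
      frobNorm_orthogonal_mul _ hQ, frobNorm_transpose]
    linarith
  have hquad : frobNorm (G * B * Bᵀ) ≤ frobNorm B ^ 2 := by
    rw [← frobNorm_transpose]
    have : (G * B * Bᵀ)ᵀ = (B * Bᵀ) * Z * Zᵀ := by
      simp [hG, Matrix.transpose_mul, Matrix.mul_assoc]
    rw [this]
    have h1 := frobNorm_mul_le_specNorm (B * Bᵀ * Z) Zᵀ
    have h2 := frobNorm_mul_le_specNorm (B * Bᵀ) Z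
    have h3 := frobNorm_mul_le B Bᵀ
    rw [specNorm_transpose, hZ] at h1
    rw [hZ] at h2
    rw [frobNorm_transpose] at h3
    nlinarith
  have hlow1 : (sigmaMin Z * frobNorm B) ^ 2 ≤ (B * G * Bᵀ).trace := by
    have := pow_le_pow_left₀ (mul_nonneg (sigmaMin_nonneg Z) (frobNorm_nonneg B))
      (sigmaMin_mul_frobNorm_le B Z) 2
    rwa [frobNorm_sq_eq_trace, Matrix.transpose_mul, Matrix.mul_assoc, ← Matrix.mul_assoc Z,
      ← Matrix.mul_assoc] at this
  have hlow2 : (sigmaMin Z * frobNorm B) ^ 2 ≤ (G * B * Bᵀ).trace := by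
    have := pow_le_pow_left₀ (mul_nonneg (sigmaMin_nonneg Z) (frobNorm_nonneg Bᵀ))
      (sigmaMin_mul_frobNorm_le Bᵀ Z) 2
    rwa [frobNorm_sq_eq_trace, Matrix.transpose_mul, Matrix.transpose_transpose,
      Matrix.mul_assoc, ← Matrix.mul_assoc Z, ← hG, Matrix.trace_mul_comm,
      frobNorm_transpose] at this
  have hcs := trace_mul_transpose_le (B * G + G * B) B
  rw [Matrix.add_mul, Matrix.trace_add] at hcs
  have hlin : frobNorm (B * G + G * B) ≤ 2 * frobNorm E + frobNorm B ^ 2 := by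
    have : B * G + G * B = (E * Qᵀ - Q * Eᵀ) - G * B * Bᵀ := by rw [← hEq]; abel
    rw [this]
    exact (frobNorm_sub_le _ _).trans (add_le_add hright hquad)
  have hb := frobNorm_nonneg B
  have hmul := mul_le_mul_of_nonneg_right hlin hb
  rcases hb.eq_or_lt with h0 | hpos
  · rw [← h0]
    have := frobNorm_nonneg E
    simpa using this
  · refine le_of_mul_le_mul_right (a := frobNorm B) ?_ hpos
    nlinarith

end Procrustes

section MaskedResidual

variable {m n : Type*} [Fintype m] [Fintype n] [DecidableEq m] [DecidableEq n]

lemma frobNorm_diagonal_diag_le {A : Matrix m m ℝ} (hA : A + Aᵀ + A * Aᵀ = 0) :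
    frobNorm (Matrix.diagonal A.diag) ≤ frobNorm A ^ 2 / 2 := by
  have hdiag : ∀ k, A k k = -(1 / 2) * (A * Aᵀ) k k := by
    intro k
    have := congrFun (congrFun hA k) k
    simp only [Matrix.add_apply, Matrix.transpose_apply, Matrix.zero_apply] at this
    linarith
  have h1 : frobNorm (Matrix.diagonal A.diag) ≤ (1 / 2) * frobNorm (A * Aᵀ) := by
    refine frobNorm_le_of_forall_row (by norm_num) fun k => ?_
    have e : (Matrix.diagonal A.diag) k ⬝ᵥ (Matrix.diagonal A.diag) k = A k k ^ 2 := by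
      simp [dotProduct, Matrix.diagonal_apply, sq]
    rw [e, hdiag, mul_pow, neg_sq]
    refine mul_le_mul_of_nonneg_left ?_ (by norm_num)
    rw [sq]
    exact Finset.single_le_sum (f := fun l => (A * Aᵀ) k l * (A * Aᵀ) k l)
      (fun _ _ => mul_self_nonneg _) (Finset.mem_univ k)
  have h2 := frobNorm_mul_le A Aᵀ
  rw [frobNorm_transpose] at h2
  nlinarith

lemma frobNorm_masked_mul_transpose_le {A : Matrix m m ℝ} (hA : A + Aᵀ + A * Aᵀ = 0)
    {Z D : Matrix m n ℝ} (hZ : specNorm Z = 1)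
    (hD : ∀ k j, D k j = if Z k j ≠ 0 then (A * Z) k j else 0) :
    frobNorm (D * Zᵀ) ≤ qmax Z * frobNorm A + frobNorm A ^ 2 / 2 := by
  set D' : Matrix m n ℝ := Matrix.of fun k => A k ᵥ* (Dk k * Z * Dtil Z k) with hD'
  have hsplit : D = D' + Matrix.diagonal A.diag * Z := by
    ext k j
    have e : D' k j = (∑ i, A k i * ((if i = k then 0 else 1) * Z i j))
        * (if Z k j ≠ 0 then 1 else 0) := by
      simp only [hD', Matrix.of_apply, Matrix.vecMul, dotProduct, Dk, Dtil,
        Matrix.mul_diagonal, Matrix.diagonal_mul, Finset.sum_mul, mul_assoc]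
    rw [hD, Matrix.add_apply, e, Matrix.diagonal_mul, Matrix.diag_apply, Matrix.mul_apply]
    by_cases hz : Z k j = 0
    · simp [hz]
    · rw [if_pos hz, if_pos hz, mul_one, ← Finset.add_sum_erase _ _ (Finset.mem_univ k),
        ← Finset.add_sum_erase _ (fun i => A k i * ((if i = k then 0 else 1) * Z i j))
          (Finset.mem_univ k)]
      rw [Finset.sum_congr rfl (g := fun i => A k i * ((if i = k then 0 else 1) * Z i j))]
      · simp [add_comm]
      · intro i hi
        simp [Finset.ne_of_mem_erase hi]
  have hmul : ∀ M : Matrix m n ℝ, frobNorm (M * Zᵀ) ≤ frobNorm M := fun M => by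
    simpa [specNorm_transpose, hZ] using frobNorm_mul_le_specNorm M Zᵀ
  have hDA : frobNorm D' ≤ qmax Z * frobNorm A := by
    have hq : 0 ≤ qmax Z := Real.iSup_nonneg fun _ => specNorm_nonneg _
    refine frobNorm_le_of_forall_row hq fun k => ?_
    refine (vecMul_dotProduct_self_le _ (A k)).trans ?_
    refine mul_le_mul_of_nonneg_right
      (pow_le_pow_left₀ (specNorm_nonneg _) (specNorm_le_qmax Z k) 2) ?_
    exact Finset.sum_nonneg fun _ _ => mul_self_nonneg _
  have hdiag := frobNorm_mul_le_specNorm (Matrix.diagonal A.diag) Z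
  rw [hZ, one_mul] at hdiag
  refine (hmul D).trans ?_
  rw [hsplit]
  exact (frobNorm_add_le _ _).trans
    (add_le_add hDA (hdiag.trans (frobNorm_diagonal_diag_le hA)))

end MaskedResidual

lemma IsHardThresh.eq_ite_of_close {n s : ℕ} {v z x : Fin n → ℝ} {b e : ℝ}
    (h : IsHardThresh s v z) (hcard : (Finset.univ.filter fun i => x i ≠ 0).card = s)
    (hb : ∀ i, x i ≠ 0 → b ≤ |x i|) (he : ∀ i, |v i - x i| ≤ e) (heb : 2 * e < b) (i : Fin n) :
    z i = if x i ≠ 0 then v i else 0 := by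
  obtain ⟨T, hT, hsep, hin, hout⟩ := h
  have hsub : (Finset.univ.filter fun i => x i ≠ 0) ⊆ T := by
    by_contra hns
    obtain ⟨i, hi, hiT⟩ := Finset.not_subset.mp hns
    obtain ⟨j, hjT, hj⟩ : ∃ j ∈ T, j ∉ Finset.univ.filter fun i => x i ≠ 0 := by
      by_contra! hall
      have hsub' : T ⊆ Finset.univ.filter fun i => x i ≠ 0 := hall
      rw [Finset.eq_of_subset_of_card_le hsub' (by rw [hcard, hT])] at hiT
      exact hiT hi
    simp only [Finset.mem_filter, Finset.mem_univ, true_and, not_not] at hi hj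
    have h1 := hsep j hjT i hiT
    have h2 := he i
    have h3 := he j
    have h4 := hb i hi
    rw [hj, sub_zero] at h3
    have h5 := abs_sub_abs_le_abs_sub (x i) (v i)
    rw [abs_sub_comm] at h5
    linarith
  have hTeq := Finset.eq_of_subset_of_card_le hsub (by rw [hcard, hT])
  by_cases hi : x i = 0
  · rw [if_neg (by simpa using hi)]
    exact hout i (by rw [← hTeq]; simp [hi])
  · rw [if_pos hi]
    exact hin i (by rw [← hTeq]; simp [hi])

lemma exists_pos_forall_le_abs_of_ne_zero {m n : Type*} [Finite m] [Finite n]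
    (Z : Matrix m n ℝ) : ∃ b > 0, ∀ i j, Z i j ≠ 0 → b ≤ |Z i j| := by
  cases nonempty_fintype m
  cases nonempty_fintype n
  refine ⟨(insert 1 ((Finset.univ.filter fun p : m × n => Z p.1 p.2 ≠ 0).image
    fun p => |Z p.1 p.2|)).min' (Finset.insert_nonempty _ _), ?_, fun i j hij => ?_⟩
  · rw [gt_iff_lt, Finset.lt_min'_iff]
    simp only [Finset.mem_insert, Finset.mem_image, Finset.mem_filter]
    rintro _ (rfl | ⟨p, ⟨-, hp⟩, rfl⟩)
    exacts [one_pos, abs_pos.mpr hp]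
  · refine Finset.min'_le _ _ (Finset.mem_insert_of_mem (Finset.mem_image.mpr ⟨(i, j), ?_, rfl⟩))
    simpa using hij

/-- One step of the alternating algorithm: the new coefficients are no further from `Z` than the
old transform is from `W`, and the new transform is closer to `W` by the factor `q`. -/
lemma alternating_step {n N s : ℕ} {W Wo Wn : Matrix (Fin n) (Fin n) ℝ}
    {Z P Y : Matrix (Fin n) (Fin N) ℝ} {b e q : ℝ}
    (hW : Wᵀ * W = 1) (hP : P = Wᵀ * Z) (hZ : specNorm Z = 1) (hσ : 0 < sigmaMin Z)
    (hcols : ∀ j, (Finset.univ.filter (fun i => Z i j ≠ 0)).card = s)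
    (hb : ∀ i j, Z i j ≠ 0 → b ≤ |Z i j|) (heb : 2 * e < b)
    (hq : qmax Z + (1 / 2 + 2 / sigmaMin Z ^ 2) * e ≤ sigmaMin Z ^ 2 * q)
    (hWo : Woᵀ * Wo = 1) (hWoe : frobNorm (Wo - W) ≤ e)
    (hY : ∀ j, IsHardThresh s (fun i => (Wo * P) i j) (fun i => Y i j))
    (hWn : Wnᵀ * Wn = 1)
    (hmin : ∀ W' : Matrix (Fin n) (Fin n) ℝ, W'ᵀ * W' = 1 →
      frobNorm (Wn * P - Y) ≤ frobNorm (W' * P - Y)) :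
    frobNorm (Y - Z) ≤ frobNorm (Wo - W) ∧ frobNorm (Wn - W) ≤ q * frobNorm (Wo - W) := by
  have hW' : W * Wᵀ = 1 := mul_eq_one_comm.mp hW
  have hnorm : ∀ V : Matrix (Fin n) (Fin n) ℝ, frobNorm (V * Wᵀ - 1) = frobNorm (V - W) := by
    intro V
    rw [← hW', ← Matrix.sub_mul, frobNorm_mul_of_mul_transpose_eq_one _ (by simpa using hW)]
  have horth : ∀ V : Matrix (Fin n) (Fin n) ℝ, Vᵀ * V = 1 → (V * Wᵀ)ᵀ * (V * Wᵀ) = 1 := by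
    intro V hV
    rw [Matrix.transpose_mul, Matrix.transpose_transpose, Matrix.mul_assoc,
      ← Matrix.mul_assoc Vᵀ, hV, Matrix.one_mul, hW']
  have hVP : ∀ V : Matrix (Fin n) (Fin n) ℝ, V * P = V * Wᵀ * Z := fun V => by
    rw [hP, Matrix.mul_assoc]
  set A := Wo * Wᵀ - 1 with hA
  have hAZ : Wo * P - Z = A * Z := by rw [hVP, hA, Matrix.sub_mul, Matrix.one_mul]
  have hAe : frobNorm A = frobNorm (Wo - W) := hnorm Wo
  have hAZle : frobNorm (A * Z) ≤ frobNorm A := by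
    simpa [hZ] using frobNorm_mul_le_specNorm A Z
  have hAA : A + Aᵀ + A * Aᵀ = 0 :=
    sub_one_add_transpose_add_mul_transpose (mul_eq_one_comm.mp (horth Wo hWo))
  have hYmask : ∀ k j, Y k j = if Z k j ≠ 0 then (Wo * P) k j else 0 := fun k j =>
    (hY j).eq_ite_of_close (x := fun i => Z i j) (hcols j) (fun i => hb i j)
      (fun i => by
        have := abs_apply_le_frobNorm (Wo * P - Z) i j
        rw [hAZ] at this
        rw [← Matrix.sub_apply, hAZ]
        linarith) heb k
  have hD : ∀ k j, (Y - Z) k j = if Z k j ≠ 0 then (A * Z) k j else 0 := by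
    intro k j
    rw [Matrix.sub_apply, hYmask, ← hAZ, Matrix.sub_apply]
    by_cases hz : Z k j = 0 <;> simp [hz]
  have hDle : frobNorm (Y - Z) ≤ frobNorm A := by
    refine le_trans ?_ hAZle
    refine Real.sqrt_le_sqrt (Finset.sum_le_sum fun k _ => Finset.sum_le_sum fun j _ => ?_)
    rw [hD]
    split_ifs
    · exact le_rfl
    · rw [zero_pow two_ne_zero]
      exact sq_nonneg _
  refine ⟨hAe ▸ hDle, ?_⟩
  have hmin' : ∀ R : Matrix (Fin n) (Fin n) ℝ, Rᵀ * R = 1 →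
      frobNorm (Wn * Wᵀ * Z - Y) ≤ frobNorm (R * Z - Y) := by
    intro R hR
    have h := hmin (R * W) (by
      rw [Matrix.transpose_mul, Matrix.mul_assoc, ← Matrix.mul_assoc Rᵀ, hR, Matrix.one_mul, hW])
    rwa [hVP, hVP, Matrix.mul_assoc R, hW', Matrix.mul_one] at h
  have h1 := procrustes_frobNorm_sub_one_le Z Y hmin'
  have h2 := procrustes_perturbation (horth Wn hWn) Z Y hZ hmin'
  have h3 := frobNorm_masked_mul_transpose_le hAA hZ hD
  rw [hnorm] at h1 h2
  rw [← hAe] at hWoe ⊢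
  set σ := sigmaMin Z
  set β := frobNorm (Wn - W)
  set α := frobNorm A
  have hα : 0 ≤ α := frobNorm_nonneg _
  have hβ : 0 ≤ β := frobNorm_nonneg _
  have hβα : β ≤ 2 * α / σ := by
    rw [le_div_iff₀ hσ]
    linarith
  have hβ2 : β ^ 2 ≤ 4 / σ ^ 2 * (α * α) := by
    refine (pow_le_pow_left₀ hβ hβα 2).trans_eq ?_
    rw [div_pow]
    ring
  have hc : 0 ≤ 1 / 2 + 2 / σ ^ 2 := by positivity
  have h4 : (1 / 2 + 2 / σ ^ 2) * (α * α) ≤ (1 / 2 + 2 / σ ^ 2) * e * α := by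
    rw [mul_assoc]
    exact mul_le_mul_of_nonneg_left (mul_le_mul_of_nonneg_right hWoe hα) hc
  have h5 := mul_le_mul_of_nonneg_right hq hα
  refine le_of_mul_le_mul_left (a := σ ^ 2) ?_ (by positivity)
  have h6 : 4 / σ ^ 2 * (α * α) = 2 * (2 / σ ^ 2 * (α * α)) := by ring
  nlinarith

/-- linear convergence of the alternating algorithm under the generative
model with full-row-rank coefficients. -/
theorem stmt1 (n N s : ℕ) (hs : 1 ≤ s) (hsn : s ≤ n)
    (Wstar : Matrix (Fin n) (Fin n) ℝ) (Zstar P : Matrix (Fin n) (Fin N) ℝ)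
    (hWorth : Wstarᵀ * Wstar = 1)
    (hP : P = Wstarᵀ * Zstar)
    (hPnorm : specNorm P = 1)
    (hcols : ∀ j, (Finset.univ.filter (fun i => Zstar i j ≠ 0)).card = s)
    (hrank : Zstar.rank = n)
    (hq : condNum Zstar ^ 4 * qmax Zstar < 1) :
    ∀ qbar : ℝ, condNum Zstar ^ 4 * qmax Zstar < qbar → qbar < 1 →
      ∃ ε > 0, ∀ W0 : Matrix (Fin n) (Fin n) ℝ,
        W0ᵀ * W0 = 1 → frobNorm (W0 - Wstar) ≤ ε →
        ∀ (Zs : ℕ → Matrix (Fin n) (Fin N) ℝ) (Ws : ℕ → Matrix (Fin n) (Fin n) ℝ),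
          Ws 0 = W0 →
          (∀ t j, IsHardThresh s (fun i => (Ws t * P) i j) (fun i => Zs (t + 1) i j)) →
          (∀ t, (Ws (t + 1))ᵀ * Ws (t + 1) = 1 ∧
            ∀ W' : Matrix (Fin n) (Fin n) ℝ, W'ᵀ * W' = 1 →
              frobNorm (Ws (t + 1) * P - Zs (t + 1)) ≤ frobNorm (W' * P - Zs (t + 1))) →
          ∀ t : ℕ, frobNorm (Zs (t + 1) - Zstar) ≤ qbar ^ t * ε ∧
            frobNorm (Ws (t + 1) - Wstar) ≤ qbar ^ (t + 1) * ε := by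
  intro qbar hqbar hqbar1
  have : Nonempty (Fin n) := ⟨⟨0, by omega⟩⟩
  have hW' : Wstar * Wstarᵀ = 1 := mul_eq_one_comm.mp hWorth
  have hZ : specNorm Zstar = 1 := by
    have h := specNorm_orthogonal_mul Zstar (Q := Wstarᵀ) (by simpa using hW')
    rw [← h, ← hP, hPnorm]
  have hσ : 0 < sigmaMin Zstar := sigmaMin_pos Zstar (by simpa using hrank)
  have hσ1 : sigmaMin Zstar ≤ 1 := hZ ▸ sigmaMin_le_specNorm Zstar
  have hq0 : 0 ≤ qmax Zstar := Real.iSup_nonneg fun _ => specNorm_nonneg _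
  obtain ⟨b, hb0, hb⟩ := exists_pos_forall_le_abs_of_ne_zero Zstar
  have hκ : condNum Zstar ^ 4 * qmax Zstar = qmax Zstar / sigmaMin Zstar ^ 4 := by
    rw [condNum, hZ, div_pow, one_pow]
    ring
  rw [hκ] at hqbar
  have hqbar0 : 0 < qbar := lt_of_le_of_lt (by positivity) hqbar
  set σ := sigmaMin Zstar with hσdef
  have hgap : 0 < σ ^ 2 * qbar - qmax Zstar := by
    rw [div_lt_iff₀ (by positivity)] at hqbar
    have : σ ^ 4 ≤ σ ^ 2 := pow_le_pow_of_le_one hσ.le hσ1 (by norm_num)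
    nlinarith
  set c := 1 / 2 + 2 / σ ^ 2 with hc
  have hc0 : 0 < c := by positivity
  refine ⟨min (b / 4) ((σ ^ 2 * qbar - qmax Zstar) / c), by positivity, ?_⟩
  set e := min (b / 4) ((σ ^ 2 * qbar - qmax Zstar) / c) with he
  have he0 : 0 < e := by positivity
  intro W0 hW0 hW0e Zs Ws hWs0 hZs hWs
  have heb : 2 * e < b := by
    have := min_le_left (b / 4) ((σ ^ 2 * qbar - qmax Zstar) / c)
    linarith
  have heq : qmax Zstar + c * e ≤ σ ^ 2 * qbar := by
    have := min_le_right (b / 4) ((σ ^ 2 * qbar - qmax Zstar) / c)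
    rw [← he, le_div_iff₀ hc0] at this
    linarith
  have hWorth' : ∀ t, (Ws t)ᵀ * Ws t = 1
    | 0 => hWs0 ▸ hW0
    | t + 1 => (hWs t).1
  have hstep : ∀ t, frobNorm (Ws t - Wstar) ≤ e →
      frobNorm (Zs (t + 1) - Zstar) ≤ frobNorm (Ws t - Wstar) ∧
        frobNorm (Ws (t + 1) - Wstar) ≤ qbar * frobNorm (Ws t - Wstar) := fun t ht =>
    alternating_step hWorth hP hZ hσ hcols hb heb heq (hWorth' t) ht (hZs t) (hWs t).1 (hWs t).2
  have hle : ∀ t, qbar ^ t * e ≤ e := fun t =>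
    mul_le_of_le_one_left he0.le (pow_le_one₀ hqbar0.le hqbar1.le)
  have hconv : ∀ t, frobNorm (Ws t - Wstar) ≤ qbar ^ t * e := by
    intro t
    induction t with
    | zero => simpa [hWs0] using hW0e
    | succ t ih =>
      refine (hstep t (ih.trans (hle t))).2.trans ?_
      rw [pow_succ', mul_assoc]
      exact mul_le_mul_of_nonneg_left ih hqbar0.le
  exact fun t => ⟨(hstep t ((hconv t).trans (hle t))).1.trans (hconv t), hconv (t + 1)⟩
end

section
/- Let Z* ∈ ℝ^{n×N} be such that every column of Z* has at most 2 nonzero entries, and for 1 ≤ k ≤ n set M_k := D_k Z* D̃_k. Then M_k (M_k)^T is a diagonal matrix whose (k,k) entry is 0 and whose (i,i) entry for i ≠ k equals Σ_{l ∈ S(Z*_{(i,·)}) ∩ S(Z*_{(k,·)})} (Z*_{(i,l)})². Consequently ‖D_k Z* D̃_k‖_2² = max_{i ≠ k} Σ_{l ∈ S(Z*_{(i,·)}) ∩ S(Z*_{(k,·)})} (Z*_{(i,l)})². -/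
open Matrix MeasureTheory ProbabilityTheory Filter
open scoped Kronecker

open scoped Matrix.Norms.L2Operator in
lemma specNorm_sq_eq_of_mul_transpose_eq_diagonal {m n : Type*} [Fintype m] [Fintype n]
    [DecidableEq m] [DecidableEq n] (M : Matrix m n ℝ) (d : m → ℝ)
    (h : M * Mᵀ = diagonal d) : specNorm M ^ 2 = ‖d‖ := by
  have hM : specNorm M = ‖M‖ := rfl
  have hC := l2_opNorm_conjTranspose_mul_self Mᴴ
  rw [conjTranspose_conjTranspose, l2_opNorm_conjTranspose, conjTranspose_eq_transpose_of_trivial,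
    h, l2_opNorm_diagonal] at hC
  rw [hM, hC, sq]

lemma norm_eq_iSup_ne_of_nonneg {ι : Type*} [Fintype ι] (d : ι → ℝ) (k : ι) (hk : d k = 0)
    (hd : ∀ i, 0 ≤ d i) : ‖d‖ = ⨆ i : {i : ι // i ≠ k}, d i := by
  apply le_antisymm
  · refine (pi_norm_le_iff_of_nonneg (x := d) (Real.iSup_nonneg fun i : {i : ι // i ≠ k} => hd i)).2
      fun i => ?_
    rw [Real.norm_of_nonneg (hd i)]
    by_cases hi : i = k
    · rw [hi, hk]
      exact Real.iSup_nonneg fun i => hd i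
    · exact le_ciSup (f := fun i : {i : ι // i ≠ k} => d i) (Set.finite_range _).bddAbove ⟨i, hi⟩
  · exact Real.iSup_le (fun i => (le_abs_self _).trans (norm_le_pi_norm d i)) (norm_nonneg d)

lemma Dk_mul_mul_Dtil_apply {n N : Type*} [Fintype n] [Fintype N] [DecidableEq n]
    [DecidableEq N] (Z : Matrix n N ℝ) (k i : n) (l : N) :
    (Dk k * Z * Dtil Z k) i l = if i ≠ k ∧ Z k l ≠ 0 then Z i l else 0 := by
  rw [Dk, Dtil, mul_diagonal, diagonal_mul]
  split_ifs <;> simp_all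

/-- for columns with at most 2 nonzeros, `M_k M_kᵀ` is diagonal with the
stated entries, and the spectral norm squared is the max diagonal entry over `i ≠ k`. -/
theorem stmt5 (n N : ℕ) (Zstar : Matrix (Fin n) (Fin N) ℝ)
    (hcols : ∀ j, (Finset.univ.filter (fun i => Zstar i j ≠ 0)).card ≤ 2)
    (k : Fin n) (Mk : Matrix (Fin n) (Fin N) ℝ)
    (hMk : Mk = Dk k * Zstar * Dtil Zstar k) :
    (Mk * Mkᵀ) k k = 0 ∧
    (∀ i j : Fin n, i ≠ j → (Mk * Mkᵀ) i j = 0) ∧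
    (∀ i : Fin n, i ≠ k → (Mk * Mkᵀ) i i =
      ∑ l ∈ Finset.univ.filter (fun l => Zstar i l ≠ 0 ∧ Zstar k l ≠ 0), (Zstar i l) ^ 2) ∧
    specNorm (Dk k * Zstar * Dtil Zstar k) ^ 2 =
      ⨆ i : {i : Fin n // i ≠ k},
        ∑ l ∈ Finset.univ.filter (fun l => Zstar (i : Fin n) l ≠ 0 ∧ Zstar k l ≠ 0),
          (Zstar (i : Fin n) l) ^ 2 := by
  rw [← hMk]
  have happ : ∀ i l, Mk i l = if i ≠ k ∧ Zstar k l ≠ 0 then Zstar i l else 0 := fun i l => by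
    rw [hMk, Dk_mul_mul_Dtil_apply]
  have hkk : (Mk * Mkᵀ) k k = 0 := by simp [mul_apply, happ]
  have hoff : ∀ i j : Fin n, i ≠ j → (Mk * Mkᵀ) i j = 0 := by
    intro i j hij
    rw [mul_apply]
    refine Finset.sum_eq_zero fun l _ => ?_
    rw [transpose_apply]
    by_contra hne
    obtain ⟨hi, hj⟩ := mul_ne_zero_iff.1 hne
    simp only [happ, ne_eq, ite_eq_right_iff, Classical.not_imp] at hi hj
    obtain ⟨⟨hik, hk⟩, hi⟩ := hi
    obtain ⟨⟨hjk, -⟩, hj⟩ := hj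
    have hcard : ({i, j, k} : Finset (Fin n)).card = 3 := Finset.card_eq_three.2
      ⟨i, j, k, hij, hik, hjk, rfl⟩
    have hsub : ({i, j, k} : Finset (Fin n)) ⊆
        Finset.univ.filter (fun i => Zstar i l ≠ 0) := by
      intro x hx
      simp only [Finset.mem_insert, Finset.mem_singleton] at hx
      rcases hx with rfl | rfl | rfl <;> simp [*]
    have := (Finset.card_le_card hsub).trans (hcols l)
    omega
  have hdiag : ∀ i : Fin n, i ≠ k → (Mk * Mkᵀ) i i =
      ∑ l ∈ Finset.univ.filter (fun l => Zstar i l ≠ 0 ∧ Zstar k l ≠ 0), (Zstar i l) ^ 2 := by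
    intro i hi
    rw [mul_apply, Finset.sum_filter]
    refine Finset.sum_congr rfl fun l _ => ?_
    rw [transpose_apply, happ, ← sq]
    by_cases h : Zstar i l = 0 <;> by_cases h' : Zstar k l = 0 <;> simp [hi, h, h']
  refine ⟨hkk, hoff, hdiag, ?_⟩
  have hd : Mk * Mkᵀ = diagonal fun i => (Mk * Mkᵀ) i i := by
    ext i j
    by_cases hij : i = j
    · simp [hij]
    · rw [hoff i j hij, diagonal_apply_ne _ hij]
  rw [specNorm_sq_eq_of_mul_transpose_eq_diagonal Mk _ hd,
    norm_eq_iSup_ne_of_nonneg (fun i => (Mk * Mkᵀ) i i) k hkk]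
  · exact iSup_congr fun i => hdiag i i.2
  · intro i
    rw [mul_apply]
    exact Finset.sum_nonneg fun l _ => mul_self_nonneg _
end

section
/- Let z* ∈ ℝ^n have exactly s nonzero entries (1 ≤ s ≤ n) and let e ∈ ℝ^n satisfy ‖e‖_∞ < ½ β(z*). Then any z = H_s(z* + e) satisfies: the thresholding index set T necessarily equals the support of z*; consequently z agrees with z* + e on the support of z* and is zero elsewhere, the support of z equals the support of z*, and ‖z − z*‖_2 ≤ ‖e‖_2. -/
open Matrix MeasureTheory ProbabilityTheory Filter
open scoped Kronecker

theorem betaMin_le_abs {n : ℕ} {v : Fin n → ℝ} {i : Fin n} (hi : v i ≠ 0) :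
    betaMin v ≤ |v i| :=
  csInf_le ⟨0, by rintro c ⟨j, -, rfl⟩; exact abs_nonneg _⟩ ⟨i, hi, rfl⟩

theorem l2norm_le_l2norm {n : ℕ} {v w : Fin n → ℝ} (h : ∀ i, |v i| ≤ |w i|) :
    l2norm v ≤ l2norm w :=
  Real.sqrt_le_sqrt (Finset.sum_le_sum fun i _ => sq_le_sq.mpr (h i))

/-- hard thresholding of a sparse vector plus a small perturbation
recovers the support exactly. -/
theorem stmt7 (n s : ℕ) (hs : 1 ≤ s) (hsn : s ≤ n)
    (zstar e z : Fin n → ℝ)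
    (hzs : (Finset.univ.filter (fun i => zstar i ≠ 0)).card = s)
    (he : (⨆ i : Fin n, |e i|) < (1 / 2) * betaMin zstar)
    (T : Finset (Fin n))
    (hT : T.card = s)
    (hTmax : ∀ i ∈ T, ∀ j ∉ T, |zstar j + e j| ≤ |zstar i + e i|)
    (hzT : ∀ i ∈ T, z i = zstar i + e i)
    (hzTc : ∀ i ∉ T, z i = 0) :
    T = Finset.univ.filter (fun i => zstar i ≠ 0) ∧
    (∀ i, zstar i ≠ 0 → z i = zstar i + e i) ∧
    (∀ i, zstar i = 0 → z i = 0) ∧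
    {i : Fin n | z i ≠ 0} = {i : Fin n | zstar i ≠ 0} ∧
    l2norm (fun i => z i - zstar i) ≤ l2norm e := by
  have he_lt (i) : |e i| < 1 / 2 * betaMin zstar :=
    (le_ciSup (Set.finite_range fun i => |e i|).bddAbove i).trans_lt he
  have habs_gt {i} (hi : zstar i ≠ 0) : 1 / 2 * betaMin zstar < |zstar i + e i| := by
    have h₁ := betaMin_le_abs hi
    have h₂ := abs_sub_abs_le_abs_sub (zstar i) (-e i)
    rw [abs_neg, sub_neg_eq_add] at h₂
    linarith [he_lt i]
  have hsupp : T = Finset.univ.filter (fun i => zstar i ≠ 0) := by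
    symm
    refine Finset.eq_of_subset_of_card_le (fun j hj => ?_) (hT.trans hzs.symm).le
    by_contra hjT
    have hnot : ¬ T ⊆ Finset.univ.filter (fun i => zstar i ≠ 0) := fun hsub =>
      hjT (Finset.eq_of_subset_of_card_le hsub (hzs.trans hT.symm).le ▸ hj)
    obtain ⟨i, hiT, hi⟩ := Finset.not_subset.mp hnot
    have hi0 : zstar i = 0 := by simpa using hi
    have hle := hTmax i hiT j hjT
    rw [hi0, zero_add] at hle
    linarith [he_lt i, habs_gt (Finset.mem_filter.mp hj).2]
  have hz {i} (hi : zstar i ≠ 0) : z i = zstar i + e i := hzT i (by simpa [hsupp] using hi)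
  have hz0 {i} (hi : zstar i = 0) : z i = 0 := hzTc i (by simpa [hsupp] using hi)
  refine ⟨hsupp, fun i => hz, fun i => hz0, ?_, l2norm_le_l2norm fun i => ?_⟩
  · ext i
    refine ⟨mt hz0, fun hi => ?_⟩
    have hpos := (abs_nonneg (e i)).trans_lt ((he_lt i).trans (habs_gt hi))
    rw [← hz hi] at hpos
    exact abs_pos.mp hpos
  · by_cases hi : zstar i = 0
    · simp [hz0 hi, hi]
    · simp [hz hi]
end
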